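/- arXiv:1301.2031 — 2 statements merged into one kernel-verified Lean document; each statement's English description precedes it below -/
import Mathlib

section
/- Let n ≥ 1 and let e_1, …, e_{n+1} be the standard basis of ℝ^{n+1}. Let Δ' be the convex hull of the finite set {0, e_{n+1}} ∪ {e_i + e_{n+1} : 1 ≤ i ≤ n} ∪ {−e_i + e_{n+1} : 1 ≤ i ≤ n}. Then the Lebesgue measure (volume) of Δ' equals 2^n / (n+1)!. -/
open MeasureTheory in
theorem volume_sum_abs_le {n : ℕ} (hn : 1 ≤ n) (r : ℝ) :
    volume {y : Fin n → ℝ | ∑ i, |y i| ≤ r} =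
      ENNReal.ofReal r ^ n * ENNReal.ofReal (2 ^ n / n.factorial) := by
  have : Nonempty (Fin n) := ⟨⟨0, hn⟩⟩
  have h := volume_sum_rpow_le (Fin n) le_rfl r
  have hG : Real.Gamma (1 / 1 + 1) = 1 := by
    rw [div_one, show (1 : ℝ) + 1 = 2 by norm_num, Real.Gamma_two]
  rw [hG, div_one (Fintype.card (Fin n) : ℝ), Real.Gamma_nat_eq_factorial] at h
  simpa using h

theorem convexHull_zero_pyramid_eq (n : ℕ) :
    convexHull ℝ
      (({0, Pi.single (Fin.last n) 1} ∪
          Set.range (fun i : Fin n =>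
            Pi.single i.castSucc (1 : ℝ) + Pi.single (Fin.last n) 1) ∪
          Set.range (fun i : Fin n =>
            -Pi.single i.castSucc (1 : ℝ) + Pi.single (Fin.last n) 1)) :
        Set (Fin (n + 1) → ℝ)) =
    {x | ∑ i : Fin n, |x i.castSucc| ≤ x (Fin.last n) ∧ x (Fin.last n) ≤ 1} := by
  apply Set.Subset.antisymm
  · refine convexHull_min ?_ ?_
    · have key : ∀ i : Fin n, ∑ j : Fin n,
          |(Pi.single i.castSucc (1 : ℝ) : Fin (n + 1) → ℝ) j.castSucc| = 1 := fun i => by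
        rw [Finset.sum_eq_single i]
        · simp
        · intro j _ hj
          simp [hj]
        · simp
      rintro x (((rfl | rfl) | ⟨i, rfl⟩) | ⟨i, rfl⟩)
      · simp
      · simp [Fin.castSucc_ne_last]
      · simp [key, Fin.castSucc_ne_last, (Fin.castSucc_ne_last _).symm]
      · simp [key, Fin.castSucc_ne_last, (Fin.castSucc_ne_last _).symm]
    · rintro x ⟨hx, hx'⟩ y ⟨hy, hy'⟩ a b ha hb hab
      refine ⟨?_, ?_⟩
      · simp only [Pi.add_apply, Pi.smul_apply, smul_eq_mul]
        calc ∑ i : Fin n, |a * x i.castSucc + b * y i.castSucc|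
            ≤ ∑ i : Fin n, (a * |x i.castSucc| + b * |y i.castSucc|) := by
              refine Finset.sum_le_sum fun i _ => (abs_add_le _ _).trans_eq ?_
              rw [abs_mul, abs_mul, abs_of_nonneg ha, abs_of_nonneg hb]
          _ = a * ∑ i : Fin n, |x i.castSucc| + b * ∑ i : Fin n, |y i.castSucc| := by
              rw [Finset.sum_add_distrib, Finset.mul_sum, Finset.mul_sum]
          _ ≤ _ := by gcongr
      · simp only [Pi.add_apply, Pi.smul_apply, smul_eq_mul]
        nlinarith
  · rintro x ⟨hx, hx'⟩
    set S := (({0, Pi.single (Fin.last n) 1} ∪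
          Set.range (fun i : Fin n =>
            Pi.single i.castSucc (1 : ℝ) + Pi.single (Fin.last n) 1) ∪
          Set.range (fun i : Fin n =>
            -Pi.single i.castSucc (1 : ℝ) + Pi.single (Fin.last n) 1)) :
        Set (Fin (n + 1) → ℝ)) with hS
    let w : Option (Option (Fin n)) → ℝ := fun o => o.elim (1 - x (Fin.last n)) fun o' =>
      o'.elim (x (Fin.last n) - ∑ i : Fin n, |x i.castSucc|) fun i => |x i.castSucc|
    let v : Option (Option (Fin n)) → Fin (n + 1) → ℝ := fun o => o.elim 0 fun o' =>
      o'.elim (Pi.single (Fin.last n) 1) fun i =>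
        (if 0 ≤ x i.castSucc then Pi.single i.castSucc (1 : ℝ) else -Pi.single i.castSucc (1 : ℝ))
          + Pi.single (Fin.last n) 1
    have hmem : ∑ o, w o • v o ∈ convexHull ℝ S := by
      refine (convex_convexHull ℝ S).sum_mem ?_ ?_ ?_
      · rintro (_ | _ | i) _
        · exact sub_nonneg.2 hx'
        · exact sub_nonneg.2 hx
        · exact abs_nonneg _
      · simp [w, Fintype.sum_option]
      · rintro (_ | _ | i) _ <;> apply subset_convexHull ℝ S
        · exact Or.inl (Or.inl (Or.inl rfl))
        · exact Or.inl (Or.inl (Or.inr rfl))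
        · by_cases h : 0 ≤ x i.castSucc
          · exact Or.inl (Or.inr ⟨i, by simp [v, h]⟩)
          · exact Or.inr ⟨i, by simp [v, h]⟩
    have hterm : ∀ i j : Fin n, |x i.castSucc| *
        (if 0 ≤ x i.castSucc then Pi.single i.castSucc (1 : ℝ)
          else -Pi.single i.castSucc (1 : ℝ) : Fin (n + 1) → ℝ) j.castSucc =
        if i = j then x i.castSucc else 0 := fun i j => by
      by_cases hij : i = j
      · subst hij
        rw [if_pos rfl]
        split_ifs with h
        · simp [abs_of_nonneg h]
        · simp [abs_of_neg (not_le.1 h)]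
      · split_ifs <;> simp [Ne.symm hij]
    have hlast : ∀ i : Fin n, (if 0 ≤ x i.castSucc then Pi.single i.castSucc (1 : ℝ)
          else -Pi.single i.castSucc (1 : ℝ) : Fin (n + 1) → ℝ) (Fin.last n) = 0 := fun i => by
      split_ifs <;> simp [(Fin.castSucc_ne_last _).symm]
    convert hmem using 1
    funext k
    simp only [Finset.sum_apply, Fintype.sum_option, Pi.smul_apply, smul_eq_mul, Pi.add_apply,
      w, v, Option.elim]
    refine Fin.lastCases ?_ (fun j => ?_) k
    · simp [hlast]
    · simp [Fin.castSucc_ne_last, hterm]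

open MeasureTheory in
theorem volume_sum_abs_castSucc_le {n : ℕ} (hn : 1 ≤ n) :
    volume {x : Fin (n + 1) → ℝ |
      ∑ i : Fin n, |x i.castSucc| ≤ x (Fin.last n) ∧ x (Fin.last n) ≤ 1} =
      ENNReal.ofReal (2 ^ n / (n + 1).factorial) := by
  let T : Set (ℝ × (Fin n → ℝ)) := {p | ∑ i, |p.2 i| ≤ p.1 ∧ p.1 ≤ 1}
  have hT : MeasurableSet T := by
    have h₁ : IsClosed {p : ℝ × (Fin n → ℝ) | ∑ i, |p.2 i| ≤ p.1} :=
      isClosed_le (by fun_prop) (by fun_prop)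
    have h₂ : IsClosed {p : ℝ × (Fin n → ℝ) | p.1 ≤ 1} := isClosed_le (by fun_prop) (by fun_prop)
    exact (h₁.inter h₂).measurableSet
  have hpre := (volume_preserving_piFinSuccAbove (fun _ : Fin (n + 1) => ℝ)
    (Fin.last n)).measure_preimage hT.nullMeasurableSet
  have hset : {x : Fin (n + 1) → ℝ |
      ∑ i : Fin n, |x i.castSucc| ≤ x (Fin.last n) ∧ x (Fin.last n) ≤ 1} =
      (MeasurableEquiv.piFinSuccAbove (fun _ : Fin (n + 1) => ℝ) (Fin.last n)) ⁻¹' T := by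
    ext x
    simp [T, MeasurableEquiv.piFinSuccAbove, Fin.init]
  have hslice : ∀ t : ℝ, volume (Prod.mk t ⁻¹' T) =
      (Set.Ioc (0 : ℝ) 1).indicator (fun t => ENNReal.ofReal (t ^ n * (2 ^ n / n.factorial))) t := by
    intro t
    by_cases ht : t ≤ 1
    · have : Prod.mk t ⁻¹' T = {y : Fin n → ℝ | ∑ i, |y i| ≤ t} := by
        ext y
        simp [T, ht]
      rw [this, volume_sum_abs_le hn]
      by_cases h0 : 0 < t
      · rw [Set.indicator_of_mem (Set.mem_Ioc.2 ⟨h0, ht⟩),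
          ENNReal.ofReal_mul (by positivity), ENNReal.ofReal_pow h0.le]
      · rw [Set.indicator_of_notMem (fun h => h0 h.1), ENNReal.ofReal_of_nonpos (not_lt.1 h0),
          zero_pow (by lia), zero_mul]
    · have : Prod.mk t ⁻¹' T = ∅ := by
        ext y
        simp [T, ht]
      rw [this, Set.indicator_of_notMem (fun h => ht h.2), measure_empty]
  rw [hset, hpre, Measure.volume_eq_prod, Measure.prod_apply hT]
  simp_rw [hslice]
  rw [lintegral_indicator measurableSet_Ioc, ← ofReal_integral_eq_lintegral_ofReal,
    ← intervalIntegral.integral_of_le zero_le_one, intervalIntegral.integral_mul_const,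
    integral_pow, Nat.factorial_succ]
  · congr 1
    push_cast
    field_simp
    simp
  · exact (Continuous.integrableOn_Icc (by fun_prop)).mono_set Set.Ioc_subset_Icc_self
  · refine (ae_restrict_mem measurableSet_Ioc).mono fun t ht => ?_
    have := ht.1
    simp only [Pi.zero_apply]
    positivity


theorem stmt8 (n : ℕ) (hn : 1 ≤ n) :
    MeasureTheory.volume
        (convexHull ℝ
          (({0, Pi.single (Fin.last n) 1} ∪
              Set.range (fun i : Fin n =>
                Pi.single i.castSucc (1 : ℝ) + Pi.single (Fin.last n) 1) ∪
              Set.range (fun i : Fin n =>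
                -Pi.single i.castSucc (1 : ℝ) + Pi.single (Fin.last n) 1)) :
            Set (Fin (n + 1) → ℝ))) =
      ENNReal.ofReal (2 ^ n / (Nat.factorial (n + 1))) := by
  rw [convexHull_zero_pyramid_eq, volume_sum_abs_castSucc_le hn]
end

section
/- Let K be a field of characteristic different from 2, let n ≥ 1, and let a_1, …, a_{n+1} be nonzero elements of K. Then the following are equivalent: (1) there exist nonzero elements x_1, …, x_n, z of K such that a_i · z · (1 − x_i^{−2}) = 0 for every 1 ≤ i ≤ n and a_1(x_1 + x_1^{−1}) + ⋯ + a_n(x_n + x_n^{−1}) + a_{n+1} = 0; (2) the product ∏_{(c_1,…,c_n) ∈ {1,−1}^n} (2c_1 a_1 + 2c_2 a_2 + ⋯ + 2c_n a_n + a_{n+1}) equals 0. -/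
theorem mul_add_inv_eq_two_mul_sign {K : Type*} [Field K] (b : Bool) (r : K) :
    r * ((if b then (1 : K) else -1) + (if b then (1 : K) else -1)⁻¹) =
      2 * (if b then (1 : K) else -1) * r := by
  cases b <;> simp <;> ring

theorem stmt14 {K : Type*} [Field K] (hchar : ringChar K ≠ 2) (n : ℕ) (hn : 1 ≤ n)
    (a : Fin (n + 1) → K) (ha : ∀ i, a i ≠ 0) :
    (∃ (x : Fin n → K) (z : K), (∀ i, x i ≠ 0) ∧ z ≠ 0 ∧
        (∀ i : Fin n, a i.castSucc * z * (1 - ((x i) ^ 2)⁻¹) = 0) ∧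
        (∑ i : Fin n, a i.castSucc * (x i + (x i)⁻¹)) + a (Fin.last n) = 0) ↔
      (∏ c : Fin n → Bool,
          ((∑ i : Fin n, 2 * (if c i then (1 : K) else -1) * a i.castSucc) +
            a (Fin.last n))) = 0 := by
  classical
  rw [Finset.prod_eq_zero_iff]
  constructor
  · rintro ⟨x, z, -, hz, hcrit, hsum⟩
    have hsign (i : Fin n) : x i = if decide (x i = 1) then (1 : K) else -1 := by
      have hinv : 1 - ((x i) ^ 2)⁻¹ = 0 :=
        (mul_eq_zero.mp (hcrit i)).resolve_left (mul_ne_zero (ha _) hz)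
      have hsq : x i ^ 2 = 1 := inv_eq_one.mp (sub_eq_zero.mp hinv).symm
      by_cases h : x i = 1
      · simp [h]
      · simpa [h] using (eq_or_eq_neg_of_sq_eq_sq (x i) 1 (by simpa using hsq)).resolve_left h
    refine ⟨fun i => decide (x i = 1), Finset.mem_univ _, ?_⟩
    rw [← hsum]
    congr 1
    refine Finset.sum_congr rfl fun i _ => ?_
    rw [← mul_add_inv_eq_two_mul_sign, ← hsign i]
  · rintro ⟨c, -, hc⟩
    refine ⟨fun i => if c i then 1 else -1, 1, fun i => ?_, one_ne_zero, fun i => ?_, ?_⟩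
    · dsimp only; split_ifs <;> simp
    · dsimp only; split_ifs <;> simp
    · simpa only [mul_add_inv_eq_two_mul_sign] using hc
end
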